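/- Let n be a positive integer and e⃗ ∈ Ω_1. A reduct of the full matrix algebra (M_n(𝔽), 𝔽, +, ×, +_𝔽, ×_𝔽, |·|) is an e⃗-Ramsey algebra if and only if it does not contain both matrix operations + and ×. -/

import Mathlib

universe u v

/-- A (heterogeneous) operation: a list of input sorts, an output sort, and an
underlying function on lists of elements (only its values on lists of the right
length and sorts matter). -/
structure HetOp (I : Type u) (U : Type v) where
  inSorts : List I
  outSort : I
  fn : List U → U

namespace HetRamsey

variable {I : Type u} {U : Type v}

/-- `f` maps the phyla prescribed by its input sorts into the phylum of its output sort. -/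
def WellSorted (A : I → Set U) (f : HetOp I U) : Prop :=
  ∀ xs : List U, List.Forall₂ (fun x ξ => x ∈ A ξ) xs f.inSorts → f.fn xs ∈ A f.outSort

/-- Apply the operations in `hs` to consecutive chunks of the list `xs`. -/
def applyChunks : List (HetOp I U) → List U → List U
  | [], _ => []
  | h :: t, xs => h.fn (xs.take h.inSorts.length) :: applyChunks t (xs.drop h.inSorts.length)

/-- The orderly terms over a family `F` of operations: `F` itself, the identity
operations, closed under orderly composition. -/
inductive OT (F : Set (HetOp I U)) : HetOp I U → Prop
  | base {f : HetOp I U} : f ∈ F → OT F f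
  | id (ξ : I) (c : HetOp I U) :
      c.inSorts = [ξ] → c.outSort = ξ → (∀ x : U, c.fn [x] = x) → OT F c
  | comp (g : HetOp I U) (hs : List (HetOp I U)) :
      g ∈ F → (∀ h ∈ hs, OT F h) →
      List.Forall₂ (fun (h : HetOp I U) ξ => h.outSort = ξ) hs g.inSorts →
      OT F ⟨(hs.map HetOp.inSorts).flatten, g.outSort, fun xs => g.fn (applyChunks hs xs)⟩

/-- `b` is `e`-sorted: the `i`-th term lies in phylum `A (e i)`. -/
def Sorted (A : I → Set U) (e : ℕ → I) (b : ℕ → U) : Prop :=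
  ∀ i, b i ∈ A (e i)

/-- `a` is a reduction of `b` with respect to the family of operations `F`:
each term `a j` is obtained by applying an orderly term over `F` to a finite
subsequence of `b`, and these finite subsequences concatenate to a
subsequence of `b`. -/
def Reduction (A : I → Set U) (F : Set (HetOp I U)) (a b : ℕ → U) : Prop :=
  ∃ (φ : ℕ → List ℕ) (f : ℕ → HetOp I U),
    (∀ j, OT F (f j)) ∧
    (∀ j, (φ j).Chain' (· < ·)) ∧
    (∀ j k, j < k → ∀ x ∈ φ j, ∀ y ∈ φ k, x < y) ∧
    (∀ j, List.Forall₂ (fun i ξ => b i ∈ A ξ) (φ j) (f j).inSorts) ∧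
    (∀ j, a j = (f j).fn ((φ j).map b))

/-- `FR^e_F(b)`: the set of first terms of `e`-sorted reductions of `b`. -/
def FR (A : I → Set U) (F : Set (HetOp I U)) (e : ℕ → I) (b : ℕ → U) : Set U :=
  { x | ∃ a : ℕ → U, Reduction A F a b ∧ Sorted A e a ∧ a 0 = x }

/-- The algebra with phyla `A` and operations `F` is an `e`-Ramsey algebra. -/
def IsERamsey (A : I → Set U) (F : Set (HetOp I U)) (e : ℕ → I) : Prop :=
  ∀ b : ℕ → U, Sorted A e b → ∀ X : Set U, X ⊆ A (e 0) →
    ∃ a : ℕ → U, Reduction A F a b ∧ Sorted A e a ∧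
      (FR A F e a ⊆ X ∨ FR A F e a ∩ X = ∅)

/-- The homogeneous algebra `(A ξ, F)` is a Ramsey algebra: it is `e`-Ramsey for
the constant sort with value `ξ`. -/
def IsRamsey (A : I → Set U) (F : Set (HetOp I U)) (ξ : I) : Prop :=
  IsERamsey A F fun _ => ξ

/-- For a homogeneous algebra: `FR_G(α) = { f(τ) : f ∈ OT(G), τ a finite subsequence of α }`. -/
def FRfin (A : I → Set U) (G : Set (HetOp I U)) (α : ℕ → U) : Set U :=
  { x | ∃ (f : HetOp I U) (ns : List ℕ), OT G f ∧ ns.Chain' (· < ·) ∧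
      List.Forall₂ (fun i ξ => α i ∈ A ξ) ns f.inSorts ∧ x = f.fn (ns.map α) }

/-- `e ∈ Ω`: every value attained by the sort `e` is attained infinitely often. -/
def InOmega (e : ℕ → I) : Prop :=
  ∀ i, {j | e j = e i}.Infinite

end HetRamsey
namespace HetRamsey

/-- The underlying universe of a matrix algebra: scalars (left) and matrices (right). -/
abbrev MatU (𝔽 : Type) (n : ℕ) : Type := 𝔽 ⊕ Matrix (Fin n) (Fin n) 𝔽

/-- The two phyla: index `0` is the scalar phylum `𝔽`, index `1` the matrix phylum. -/
def matPhyla (𝔽 : Type) (n : ℕ) : Fin 2 → Set (MatU 𝔽 n) :=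
  fun i => if i = 0 then Set.range Sum.inl else Set.range Sum.inr

def toScal {𝔽 : Type} [Zero 𝔽] {n : ℕ} : MatU 𝔽 n → 𝔽
  | Sum.inl r => r
  | Sum.inr _ => 0

def toMat {𝔽 : Type} [Zero 𝔽] {n : ℕ} : MatU 𝔽 n → Matrix (Fin n) (Fin n) 𝔽
  | Sum.inl _ => 0
  | Sum.inr m => m

/-- Matrix addition as a heterogeneous operation. -/
def matAddOp (𝔽 : Type) [Field 𝔽] (n : ℕ) : HetOp (Fin 2) (MatU 𝔽 n) :=
  ⟨[1, 1], 1, fun xs => match xs with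
    | [x, y] => Sum.inr (toMat x + toMat y)
    | _ => Sum.inl 0⟩

/-- Matrix multiplication as a heterogeneous operation. -/
def matMulOp (𝔽 : Type) [Field 𝔽] (n : ℕ) : HetOp (Fin 2) (MatU 𝔽 n) :=
  ⟨[1, 1], 1, fun xs => match xs with
    | [x, y] => Sum.inr (toMat x * toMat y)
    | _ => Sum.inl 0⟩

/-- Field addition as a heterogeneous operation. -/
def scalAddOp (𝔽 : Type) [Field 𝔽] (n : ℕ) : HetOp (Fin 2) (MatU 𝔽 n) :=
  ⟨[0, 0], 0, fun xs => match xs with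
    | [x, y] => Sum.inl (toScal x + toScal y)
    | _ => Sum.inl 0⟩

/-- Field multiplication as a heterogeneous operation. -/
def scalMulOp (𝔽 : Type) [Field 𝔽] (n : ℕ) : HetOp (Fin 2) (MatU 𝔽 n) :=
  ⟨[0, 0], 0, fun xs => match xs with
    | [x, y] => Sum.inl (toScal x * toScal y)
    | _ => Sum.inl 0⟩

/-- The determinant as a heterogeneous operation from the matrix phylum to the scalar phylum. -/
def detOp (𝔽 : Type) [Field 𝔽] (n : ℕ) : HetOp (Fin 2) (MatU 𝔽 n) :=
  ⟨[1], 0, fun xs => match xs with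
    | [x] => Sum.inl (toMat x).det
    | _ => Sum.inl 0⟩

end HetRamsey

open HetRamsey


namespace HetRamsey

section Generic

variable {I : Type*} {U : Type*}

theorem exists_increasing_blocks (l₀ : List ℕ) (good : ℕ → List ℕ → Prop)
    (h : ∀ j N, ∃ l, good j l ∧ ∀ x ∈ l, N ≤ x) :
    ∃ φ : ℕ → List ℕ, φ 0 = l₀ ∧ (∀ j, good (j + 1) (φ (j + 1))) ∧
      ∀ j k, j < k → ∀ x ∈ φ j, ∀ y ∈ φ k, x < y := by
  choose g hg hgN using h
  let st : ℕ → List ℕ × ℕ := fun j => Nat.rec (l₀, l₀.sum + 1)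
    (fun j p => (g (j + 1) p.2, p.2 + (g (j + 1) p.2).sum + 1)) j
  have hst : ∀ j, st (j + 1) = (g (j + 1) (st j).2, (st j).2 + (g (j + 1) (st j).2).sum + 1) :=
    fun j => rfl
  have hmono : Monotone fun j => (st j).2 := by
    refine monotone_nat_of_le_succ fun j => ?_
    rw [hst]
    simp only
    omega
  have hup : ∀ j, ∀ x ∈ (st j).1, x < (st j).2 := by
    intro j x hx
    cases j with
    | zero => exact Nat.lt_succ_of_le (List.le_sum_of_mem hx)
    | succ j =>
      rw [hst] at hx ⊢
      have := List.le_sum_of_mem hx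
      simp only at this ⊢
      omega
  refine ⟨fun j => (st j).1, rfl, fun j => ?_, ?_⟩
  · simp only [hst]
    exact hg _ _
  · intro j k hjk x hx y hy
    obtain ⟨k, rfl⟩ : ∃ k', k = k' + 1 := ⟨k - 1, by omega⟩
    have h1 := hup j x hx
    have h2 : (st j).2 ≤ (st k).2 := hmono (by omega)
    simp only [hst] at hy
    have h3 := hgN _ _ y hy
    omega

theorem exists_cut (l₁ l₂ : List ℕ) (h : ∀ x ∈ l₁, ∀ y ∈ l₂, x < y) :
    ∃ c, (∀ x ∈ l₁, x < c) ∧ ∀ y ∈ l₂, c ≤ y := by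
  induction l₁ with
  | nil => exact ⟨0, by simp, by simp⟩
  | cons a l₁ ih =>
    obtain ⟨c, hc₁, hc₂⟩ := ih fun x hx => h x (List.mem_cons_of_mem _ hx)
    refine ⟨max (a + 1) c, ?_, ?_⟩
    · intro x hx
      rcases List.mem_cons.1 hx with rfl | hx
      · omega
      · have := hc₁ x hx
        omega
    · intro y hy
      have h₁ := h a (by simp) y hy
      have h₂ := hc₂ y hy
      omega

/-- The identity operation on the phylum `ξ`. -/
def idOp [Inhabited U] (ξ : I) : HetOp I U := ⟨[ξ], ξ, fun xs => xs.headD default⟩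

theorem OT_idOp [Inhabited U] (F : Set (HetOp I U)) (ξ : I) : OT F (idOp ξ) :=
  OT.id ξ _ rfl rfl fun _ => rfl

theorem InOmega.exists_ge {e : ℕ → I} (he : InOmega e) (i N : ℕ) : ∃ j, N ≤ j ∧ e j = e i := by
  obtain ⟨j, hj, hN⟩ := (he i).exists_gt N
  exact ⟨j, hN.le, hj⟩

/-- Every value of an orderly term of the right sort is the first term of a sorted reduction. -/
theorem mem_FR_of_OT [Inhabited U] {A : I → Set U} {F : Set (HetOp I U)} {e : ℕ → I}
    (he : InOmega e) {a : ℕ → U} (ha : Sorted A e a) {f : HetOp I U} (hf : OT F f) {ns : List ℕ}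
    (hns : ns.IsChain (· < ·)) (hs : List.Forall₂ (fun i ξ => a i ∈ A ξ) ns f.inSorts)
    (hA : f.fn (ns.map a) ∈ A (e 0)) : f.fn (ns.map a) ∈ FR A F e a := by
  obtain ⟨φ, h0, hφ, hlt⟩ := exists_increasing_blocks ns (fun j l => ∃ i, e i = e j ∧ l = [i])
    (fun j N => by
      obtain ⟨i, hi, hij⟩ := he.exists_ge j N
      exact ⟨[i], ⟨i, hij, rfl⟩, by simpa using hi⟩)
  choose ι hι hφι using hφ
  let t : ℕ → HetOp I U := fun j => Nat.casesOn j f fun j => idOp (e (j + 1))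
  refine ⟨fun j => (t j).fn ((φ j).map a), ⟨φ, t, ?_, ?_, hlt, ?_, fun _ => rfl⟩, ?_, ?_⟩
  · intro j
    cases j with
    | zero => exact hf
    | succ j => exact OT_idOp _ _
  · intro j
    cases j with
    | zero => rw [h0]; exact hns
    | succ j => rw [hφι]; exact List.isChain_singleton _
  · intro j
    cases j with
    | zero => rw [h0]; exact hs
    | succ j =>
      rw [hφι]
      refine List.Forall₂.cons ?_ List.Forall₂.nil
      rw [← hι j]
      exact ha _
  · intro j
    cases j with
    | zero => simp only [h0]; exact hA
    | succ j =>
      simp only [hφι]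
      change a (ι j) ∈ A (e (j + 1))
      rw [← hι j]
      exact ha _
  · simp only [h0]
    rfl

theorem comp_pair_split {A : I → Set U} {b : ℕ → U} {h₁ h₂ : HetOp I U} {ns : List ℕ}
    (h : List.Forall₂ (fun i ξ => b i ∈ A ξ) ns ([h₁, h₂].map HetOp.inSorts).flatten) :
    ∃ n₁ n₂, ns = n₁ ++ n₂ ∧ List.Forall₂ (fun i ξ => b i ∈ A ξ) n₁ h₁.inSorts ∧
      List.Forall₂ (fun i ξ => b i ∈ A ξ) n₂ h₂.inSorts ∧
      applyChunks [h₁, h₂] (ns.map b) = [h₁.fn (n₁.map b), h₂.fn (n₂.map b)] := by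
  have h' : List.Forall₂ (fun i ξ => b i ∈ A ξ) ns (h₁.inSorts ++ h₂.inSorts) := by
    simpa using h
  have ht := List.forall₂_take_append _ _ _ h'
  have hd := List.forall₂_drop_append _ _ _ h'
  refine ⟨_, _, (List.take_append_drop h₁.inSorts.length ns).symm, ht, hd, ?_⟩
  have hl := hd.length_eq
  simp only [applyChunks, List.map_take, List.map_drop]
  rw [List.take_of_length_le (l := List.drop _ _)
    (by simp only [List.length_drop, List.length_map] at hl ⊢; omega)]

end Generic

variable {𝔽 : Type} {n : ℕ}

theorem mem_matPhyla_zero {x : MatU 𝔽 n} : x ∈ matPhyla 𝔽 n 0 ↔ ∃ r, Sum.inl r = x := by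
  simp [matPhyla]

theorem mem_matPhyla_one {x : MatU 𝔽 n} : x ∈ matPhyla 𝔽 n 1 ↔ ∃ m, Sum.inr m = x := by
  simp [matPhyla]

variable [Field 𝔽]

instance : Inhabited (MatU 𝔽 n) := ⟨Sum.inl 0⟩

theorem scalar_op_values {f : HetOp (Fin 2) (MatU 𝔽 n)}
    (hf : f = scalAddOp 𝔽 n ∨ f = scalMulOp 𝔽 n ∨ f = detOp 𝔽 n) :
    f.outSort = 0 ∧ ∀ xs, ∃ r, f.fn xs = Sum.inl r := by
  rcases hf with rfl | rfl | rfl <;> refine ⟨rfl, fun xs => ?_⟩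
  · simp only [scalAddOp]
    split <;> exact ⟨_, rfl⟩
  · simp only [scalMulOp]
    split <;> exact ⟨_, rfl⟩
  · simp only [detOp]
    split <;> exact ⟨_, rfl⟩

/-- Induction principle for the matrix values of orderly terms. -/
theorem OT_matrix_value {S : Set (HetOp (Fin 2) (MatU 𝔽 n))}
    (hS : S ⊆ {matAddOp 𝔽 n, matMulOp 𝔽 n, scalAddOp 𝔽 n, scalMulOp 𝔽 n, detOp 𝔽 n})
    (b : ℕ → MatU 𝔽 n) (Q : List ℕ → Matrix (Fin n) (Fin n) 𝔽 → Prop)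
    (hsingle : ∀ i m, b i = Sum.inr m → Q [i] m)
    (hadd : matAddOp 𝔽 n ∈ S → ∀ l₁ l₂ x y, Q l₁ x → Q l₂ y → Q (l₁ ++ l₂) (x + y))
    (hmul : matMulOp 𝔽 n ∈ S → ∀ l₁ l₂ x y, Q l₁ x → Q l₂ y → Q (l₁ ++ l₂) (x * y))
    {f : HetOp (Fin 2) (MatU 𝔽 n)} (hf : OT S f) :
    ∀ ns : List ℕ, List.Forall₂ (fun i ξ => b i ∈ matPhyla 𝔽 n ξ) ns f.inSorts →
      f.fn (ns.map b) ∈ matPhyla 𝔽 n f.outSort ∧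
        ∀ m, f.fn (ns.map b) = Sum.inr m → Q ns m := by
  induction hf with
  | @base f hf =>
    intro ns hns
    rcases hS hf with rfl | rfl | h
    · obtain _ | ⟨hi, _ | ⟨hj, _ | _⟩⟩ := hns
      obtain ⟨x, hx⟩ := mem_matPhyla_one.1 hi
      obtain ⟨y, hy⟩ := mem_matPhyla_one.1 hj
      refine ⟨mem_matPhyla_one.2 ⟨_, rfl⟩, fun m hm => ?_⟩
      have := hadd hf _ _ _ _ (hsingle _ _ hx.symm) (hsingle _ _ hy.symm)
      simp only [matAddOp, List.map_cons, List.map_nil, ← hx, ← hy, toMat, Sum.inr.injEq] at hm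
      rwa [hm] at this
    · obtain _ | ⟨hi, _ | ⟨hj, _ | _⟩⟩ := hns
      obtain ⟨x, hx⟩ := mem_matPhyla_one.1 hi
      obtain ⟨y, hy⟩ := mem_matPhyla_one.1 hj
      refine ⟨mem_matPhyla_one.2 ⟨_, rfl⟩, fun m hm => ?_⟩
      have := hmul hf _ _ _ _ (hsingle _ _ hx.symm) (hsingle _ _ hy.symm)
      simp only [matMulOp, List.map_cons, List.map_nil, ← hx, ← hy, toMat, Sum.inr.injEq] at hm
      rwa [hm] at this
    · obtain ⟨ho, hv⟩ := scalar_op_values h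
      obtain ⟨r, hr⟩ := hv (ns.map b)
      rw [ho, hr]
      exact ⟨mem_matPhyla_zero.2 ⟨_, rfl⟩, fun m hm => by cases hm⟩
  | id ξ c hin hout hc =>
    intro ns hns
    rw [hin] at hns
    obtain _ | ⟨hi, _ | _⟩ := hns
    rw [List.map_cons, List.map_nil, hc, hout]
    exact ⟨hi, fun m hm => hsingle _ _ hm⟩
  | comp g hs hg hhs hout ih =>
    intro ns hns
    rcases hS hg with rfl | rfl | h
    · obtain _ | ⟨h₁, _ | ⟨h₂, _ | _⟩⟩ := hout
      obtain ⟨n₁, n₂, rfl, hn₁, hn₂, hch⟩ := comp_pair_split hns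
      obtain ⟨hA₁, hQ₁⟩ := ih _ (by simp) n₁ hn₁
      obtain ⟨hA₂, hQ₂⟩ := ih _ (by simp) n₂ hn₂
      rw [h₁] at hA₁
      rw [h₂] at hA₂
      obtain ⟨x, hx⟩ := mem_matPhyla_one.1 hA₁
      obtain ⟨y, hy⟩ := mem_matPhyla_one.1 hA₂
      have := hadd hg _ _ _ _ (hQ₁ _ hx.symm) (hQ₂ _ hy.symm)
      simp only [hch, ← hx, ← hy, matAddOp, toMat]
      exact ⟨mem_matPhyla_one.2 ⟨_, rfl⟩, fun m hm => by cases hm; exact this⟩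
    · obtain _ | ⟨h₁, _ | ⟨h₂, _ | _⟩⟩ := hout
      obtain ⟨n₁, n₂, rfl, hn₁, hn₂, hch⟩ := comp_pair_split hns
      obtain ⟨hA₁, hQ₁⟩ := ih _ (by simp) n₁ hn₁
      obtain ⟨hA₂, hQ₂⟩ := ih _ (by simp) n₂ hn₂
      rw [h₁] at hA₁
      rw [h₂] at hA₂
      obtain ⟨x, hx⟩ := mem_matPhyla_one.1 hA₁
      obtain ⟨y, hy⟩ := mem_matPhyla_one.1 hA₂
      have := hmul hg _ _ _ _ (hQ₁ _ hx.symm) (hQ₂ _ hy.symm)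
      simp only [hch, ← hx, ← hy, matMulOp, toMat]
      exact ⟨mem_matPhyla_one.2 ⟨_, rfl⟩, fun m hm => by cases hm; exact this⟩
    · obtain ⟨ho, hv⟩ := scalar_op_values h
      obtain ⟨r, hr⟩ := hv (applyChunks hs (ns.map b))
      simp only [ho, hr]
      exact ⟨mem_matPhyla_zero.2 ⟨_, rfl⟩, fun m hm => by cases hm⟩

/-- The positive rational `z` has `2`-adic valuation `t` and `3`-adic valuation `-d`, where `t` and
`d` are positive integers whose binary digits all sit in positions `[l, h)`. -/
def IsSpread (l h : ℕ) (z : ℚ) : Prop :=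
  0 < z ∧ ∃ t d : ℕ, padicValRat 2 z = t ∧ padicValRat 3 z = -d ∧ 2 ^ l ∣ t ∧ 2 ^ l ∣ d ∧
    0 < t ∧ 0 < d ∧ t < 2 ^ h ∧ d < 2 ^ h

/-- The colour separating sums from products. -/
def IsSumColoured (z : ℚ) : Prop :=
  ∃ j : ℕ, padicValRat 2 z < 2 ^ j ∧ (2 ^ j : ℤ) ∣ padicValRat 3 z

theorem isSpread_base {k l h : ℕ} (hl : l ≤ k) (hk : k < h) :
    IsSpread l h ((2 / 3) ^ (2 ^ k)) := by
  have h2 : padicValRat 2 (2 / 3 : ℚ) = 1 := by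
    rw [padicValRat.div two_ne_zero three_ne_zero]
    have h := padicValRat.of_nat (p := 2) (n := 2)
    have h' := padicValRat.of_nat (p := 2) (n := 3)
    rw [padicValNat_self] at h
    rw [padicValNat_primes (by norm_num)] at h'
    push_cast at h h'
    rw [h, h']
    rfl
  have h3 : padicValRat 3 (2 / 3 : ℚ) = -1 := by
    rw [padicValRat.div two_ne_zero three_ne_zero]
    have h := padicValRat.of_nat (p := 3) (n := 2)
    have h' := padicValRat.of_nat (p := 3) (n := 3)
    rw [padicValNat_primes (by norm_num)] at h
    rw [padicValNat_self] at h'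
    push_cast at h h'
    rw [h, h']
    rfl
  refine ⟨by positivity, 2 ^ k, 2 ^ k, ?_, ?_, pow_dvd_pow 2 hl, pow_dvd_pow 2 hl, by positivity,
    by positivity, Nat.pow_lt_pow_right (by norm_num) hk, Nat.pow_lt_pow_right (by norm_num) hk⟩
  · rw [padicValRat.pow, h2, mul_one]
  · rw [padicValRat.pow, h3, mul_neg_one]

theorem two_pow_lt_of_dvd {l h t : ℕ} (hd : 2 ^ l ∣ t) (ht : 0 < t) (hlt : t < 2 ^ h) : l < h :=
  (Nat.pow_lt_pow_iff_right (by norm_num)).1 ((Nat.le_of_dvd ht hd).trans_lt hlt)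

theorem add_lt_two_pow {c h s t : ℕ} (hs : s < 2 ^ c) (hd : 2 ^ c ∣ t) (ht : 0 < t)
    (hlt : t < 2 ^ h) : s + t < 2 ^ h := by
  have hch := two_pow_lt_of_dvd hd ht hlt
  have h1 : 2 ^ c ∣ 2 ^ h - t := Nat.dvd_sub (pow_dvd_pow 2 hch.le) hd
  have h2 := Nat.le_of_dvd (by omega) h1
  omega

theorem padicValRat_add_of_lt {p : ℕ} [Fact p.Prime] {x y : ℚ} (hx : 0 < x) (hy : 0 < y)
    (h : padicValRat p x < padicValRat p y) : padicValRat p (x + y) = padicValRat p x :=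
  padicValRat.add_eq_of_lt (by positivity) hx.ne' hy.ne' h

theorem IsSpread.valuation_add {l c h : ℕ} {x y : ℚ} (hx : IsSpread l c x) (hy : IsSpread c h y) :
    padicValRat 2 (x + y) = padicValRat 2 x ∧ padicValRat 3 (x + y) = padicValRat 3 y := by
  obtain ⟨hx0, t, d, ht, hd, -, -, -, -, htc, hdc⟩ := hx
  obtain ⟨hy0, t', d', ht', hd', htd', hdd', ht0', hd0', -, -⟩ := hy
  have h1 := Nat.le_of_dvd ht0' htd'
  have h2 := Nat.le_of_dvd hd0' hdd'
  refine ⟨padicValRat_add_of_lt hx0 hy0 (by omega), ?_⟩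
  rw [add_comm]
  exact padicValRat_add_of_lt hy0 hx0 (by omega)

theorem IsSpread.add {l c h : ℕ} {x y : ℚ} (hx : IsSpread l c x) (hy : IsSpread c h y) :
    IsSpread l h (x + y) := by
  obtain ⟨h2, h3⟩ := hx.valuation_add hy
  obtain ⟨hx0, t, d, ht, hd, htd, hdd, ht0, hd0, htc, hdc⟩ := hx
  obtain ⟨hy0, t', d', ht', hd', htd', hdd', ht0', hd0', hth', hdh'⟩ := hy
  have hlc := two_pow_lt_of_dvd htd ht0 htc
  have hch := two_pow_lt_of_dvd htd' ht0' hth'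
  exact ⟨by positivity, t, d', h2.trans ht, h3.trans hd', htd, (pow_dvd_pow 2 hlc.le).trans hdd',
    ht0, hd0', htc.trans (Nat.pow_lt_pow_right (by norm_num) hch), hdh'⟩

theorem IsSpread.mul {l c h : ℕ} {x y : ℚ} (hx : IsSpread l c x) (hy : IsSpread c h y) :
    IsSpread l h (x * y) := by
  obtain ⟨hx0, t, d, ht, hd, htd, hdd, ht0, hd0, htc, hdc⟩ := hx
  obtain ⟨hy0, t', d', ht', hd', htd', hdd', ht0', hd0', hth', hdh'⟩ := hy
  have hlc := two_pow_lt_of_dvd htd ht0 htc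
  refine ⟨by positivity, t + t', d + d', ?_, ?_, dvd_add htd ((pow_dvd_pow 2 hlc.le).trans htd'),
    dvd_add hdd ((pow_dvd_pow 2 hlc.le).trans hdd'), by omega, by omega,
    add_lt_two_pow htc htd' ht0' hth', add_lt_two_pow hdc hdd' hd0' hdh'⟩
  · rw [padicValRat.mul hx0.ne' hy0.ne', ht, ht']
    push_cast
    ring
  · rw [padicValRat.mul hx0.ne' hy0.ne', hd, hd']
    push_cast
    ring

theorem isSumColoured_add {l c h : ℕ} {x y : ℚ} (hx : IsSpread l c x) (hy : IsSpread c h y) :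
    IsSumColoured (x + y) := by
  obtain ⟨h2, h3⟩ := hx.valuation_add hy
  obtain ⟨-, t, d, ht, -, -, -, -, -, htc, -⟩ := hx
  obtain ⟨-, t', d', -, hd', -, hdd', -⟩ := hy
  refine ⟨c, ?_, ?_⟩
  · rw [h2, ht]
    exact_mod_cast htc
  · rw [h3, hd', dvd_neg]
    exact_mod_cast hdd'

theorem not_isSumColoured_mul {l c h : ℕ} {x y : ℚ} (hx : IsSpread l c x) (hy : IsSpread c h y) :
    ¬ IsSumColoured (x * y) := by
  rintro ⟨j, hj, hdvd⟩
  obtain ⟨hx0, t, d, ht, hd, -, -, -, hd0, -, hdc⟩ := hx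
  obtain ⟨hy0, t', d', ht', hd', htd', hdd', ht0', -, -, -⟩ := hy
  rw [padicValRat.mul hx0.ne' hy0.ne', ht, ht'] at hj
  rw [padicValRat.mul hx0.ne' hy0.ne', hd, hd', ← neg_add, dvd_neg] at hdvd
  have hj' : t + t' < 2 ^ j := by exact_mod_cast hj
  have hdvd' : 2 ^ j ∣ d + d' := by exact_mod_cast hdvd
  have hcj : c < j := two_pow_lt_of_dvd htd' ht0' (by omega)
  have h1 : 2 ^ c ∣ d := (Nat.dvd_add_left hdd').1 ((pow_dvd_pow 2 hcj.le).trans hdvd')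
  exact absurd (Nat.le_of_dvd hd0 h1) (by omega)

theorem exists_isSpread_of_OT [CharZero 𝔽] {S : Set (HetOp (Fin 2) (MatU 𝔽 n))}
    (hS : S ⊆ {matAddOp 𝔽 n, matMulOp 𝔽 n, scalAddOp 𝔽 n, scalMulOp 𝔽 n, detOp 𝔽 n})
    {b : ℕ → MatU 𝔽 n}
    (hb : ∀ i m, b i = Sum.inr m →
      m = algebraMap ℚ (Matrix (Fin n) (Fin n) 𝔽) ((2 / 3) ^ (2 ^ i)))
    {f : HetOp (Fin 2) (MatU 𝔽 n)} (hf : OT S f) {ns : List ℕ} (hns : ns.Pairwise (· < ·))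
    (hs : List.Forall₂ (fun i ξ => b i ∈ matPhyla 𝔽 n ξ) ns f.inSorts)
    {m : Matrix (Fin n) (Fin n) 𝔽} (hm : f.fn (ns.map b) = Sum.inr m) :
    ∃ z : ℚ, m = algebraMap ℚ _ z ∧ ∀ l h, (∀ x ∈ ns, l ≤ x ∧ x < h) → IsSpread l h z := by
  have hop : ∀ op : ∀ {R : Type} [Ring R], R → R → R,
      (∀ x y : ℚ, algebraMap ℚ (Matrix (Fin n) (Fin n) 𝔽) (op x y) =
        op (algebraMap ℚ _ x) (algebraMap ℚ _ y)) →
      (∀ {l c h : ℕ} {x y : ℚ}, IsSpread l c x → IsSpread c h y → IsSpread l h (op x y)) →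
      ∀ (l₁ l₂ : List ℕ) (x y : Matrix (Fin n) (Fin n) 𝔽),
        (l₁.Pairwise (· < ·) → ∃ z : ℚ, x = algebraMap ℚ _ z ∧
          ∀ l h, (∀ x ∈ l₁, l ≤ x ∧ x < h) → IsSpread l h z) →
        (l₂.Pairwise (· < ·) → ∃ z : ℚ, y = algebraMap ℚ _ z ∧
          ∀ l h, (∀ x ∈ l₂, l ≤ x ∧ x < h) → IsSpread l h z) →
        (l₁ ++ l₂).Pairwise (· < ·) → ∃ z : ℚ, op x y = algebraMap ℚ _ z ∧
          ∀ l h, (∀ x ∈ l₁ ++ l₂, l ≤ x ∧ x < h) → IsSpread l h z := by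
    intro op hmap hspread l₁ l₂ x y h₁ h₂ h
    obtain ⟨hp₁, hp₂, hlt⟩ := List.pairwise_append.1 h
    obtain ⟨z₁, rfl, hz₁⟩ := h₁ hp₁
    obtain ⟨z₂, rfl, hz₂⟩ := h₂ hp₂
    obtain ⟨c, hc₁, hc₂⟩ := exists_cut l₁ l₂ hlt
    refine ⟨op z₁ z₂, (hmap _ _).symm, fun l h hlh => hspread (hz₁ l c fun x hx => ?_)
      (hz₂ c h fun x hx => ?_)⟩
    · exact ⟨(hlh x (List.mem_append_left _ hx)).1, hc₁ x hx⟩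
    · exact ⟨hc₂ x hx, (hlh x (List.mem_append_right _ hx)).2⟩
  refine (OT_matrix_value hS b (fun ns m => ns.Pairwise (· < ·) → ∃ z : ℚ, m = algebraMap ℚ _ z ∧
    ∀ l h, (∀ x ∈ ns, l ≤ x ∧ x < h) → IsSpread l h z) ?_ ?_ ?_ hf ns hs).2 m hm hns
  · intro i m him _
    refine ⟨_, hb i m him, fun l h hlh => ?_⟩
    obtain ⟨h1, h2⟩ := hlh i (by simp)
    exact isSpread_base h1 h2
  · exact fun _ => hop (fun x y => x + y) (fun x y => map_add _ x y) IsSpread.add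
  · exact fun _ => hop (fun x y => x * y) (fun x y => map_mul _ x y) IsSpread.mul

theorem not_isERamsey_of_both [CharZero 𝔽] (hn : 0 < n) {S : Set (HetOp (Fin 2) (MatU 𝔽 n))}
    (hS : S ⊆ {matAddOp 𝔽 n, matMulOp 𝔽 n, scalAddOp 𝔽 n, scalMulOp 𝔽 n, detOp 𝔽 n})
    {e : ℕ → Fin 2} (he : InOmega e) (he0 : e 0 = 1)
    (hadd : matAddOp 𝔽 n ∈ S) (hmul : matMulOp 𝔽 n ∈ S) : ¬ IsERamsey (matPhyla 𝔽 n) S e := by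
  intro hR
  have : Nonempty (Fin n) := ⟨⟨0, hn⟩⟩
  let alg := algebraMap ℚ (Matrix (Fin n) (Fin n) 𝔽)
  have hinj : Function.Injective alg := RingHom.injective alg
  let b : ℕ → MatU 𝔽 n := fun i => if e i = 0 then Sum.inl 0 else Sum.inr (alg ((2 / 3) ^ (2 ^ i)))
  have hbs : Sorted (matPhyla 𝔽 n) e b := by
    intro i
    by_cases h : e i = 0
    · simp only [b, h, if_true]
      exact mem_matPhyla_zero.2 ⟨_, rfl⟩
    · have h1 : e i = 1 := by omega
      simp only [b, h1]
      exact mem_matPhyla_one.2 ⟨_, rfl⟩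
  have hb : ∀ i m, b i = Sum.inr m → m = alg ((2 / 3) ^ (2 ^ i)) := by
    intro i m h
    simp only [b] at h
    split at h
    · cases h
    · exact (Sum.inr.inj h).symm
  obtain ⟨a, ⟨φ, f, hf, hch, hlt, hs, hval⟩, ha, hX⟩ := hR b hbs
    {x | ∃ z : ℚ, IsSumColoured z ∧ x = Sum.inr (alg z)} (by
      rintro x ⟨z, -, rfl⟩
      rw [he0]
      exact mem_matPhyla_one.2 ⟨_, rfl⟩)
  have hspread : ∀ j, e j = 1 → ∃ z : ℚ, a j = Sum.inr (alg z) ∧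
      ∀ l h, (∀ x ∈ φ j, l ≤ x ∧ x < h) → IsSpread l h z := by
    intro j hj
    have h1 := ha j
    rw [hj] at h1
    obtain ⟨m, hm⟩ := mem_matPhyla_one.1 h1
    obtain ⟨z, rfl, hz⟩ := exists_isSpread_of_OT hS hb (hf j)
      (List.isChain_iff_pairwise.1 (hch j)) (hs j) ((hval j).symm.trans hm.symm)
    exact ⟨z, hm.symm, hz⟩
  obtain ⟨q, hq0, hq⟩ := he.exists_ge 0 1
  rw [he0] at hq
  obtain ⟨x, hx, hxs⟩ := hspread 0 he0
  obtain ⟨y, hy, hys⟩ := hspread q hq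
  obtain ⟨c, hc₁, hc₂⟩ := exists_cut (φ 0) (φ q) (hlt 0 q (by omega))
  obtain ⟨h, hh, -⟩ := exists_cut (φ q) [] (by simp)
  have hxs' := hxs 0 c fun i hi => ⟨Nat.zero_le _, hc₁ i hi⟩
  have hys' := hys c h fun i hi => ⟨hc₂ i hi, hh i hi⟩
  have hchain : [0, q].IsChain (· < ·) := by simpa using Nat.lt_of_succ_le hq0
  have hforall : List.Forall₂ (fun i ξ => a i ∈ matPhyla 𝔽 n ξ) [0, q] [1, 1] := by
    have h0 := ha 0
    have h1 := ha q
    rw [he0] at h0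
    rw [hq] at h1
    exact .cons h0 (.cons h1 .nil)
  have hmem : ∀ (g : HetOp (Fin 2) (MatU 𝔽 n)) (z : ℚ), g ∈ S → g.inSorts = [1, 1] →
      g.fn [a 0, a q] = Sum.inr (alg z) → Sum.inr (alg z) ∈ FR (matPhyla 𝔽 n) S e a := by
    intro g z hg hin hz
    rw [← hz]
    refine mem_FR_of_OT he ha (OT.base hg) hchain (by rw [hin]; exact hforall) ?_
    change g.fn [a 0, a q] ∈ _
    rw [hz, he0]
    exact mem_matPhyla_one.2 ⟨_, rfl⟩
  have hsum := hmem _ (x + y) hadd rfl (by rw [hx, hy, map_add]; rfl)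
  have hprod := hmem _ (x * y) hmul rfl (by rw [hx, hy, map_mul]; rfl)
  rcases hX with hX | hX
  · obtain ⟨z, hz, heq⟩ := hX hprod
    rw [← hinj (Sum.inr.inj heq)] at hz
    exact not_isSumColoured_mul hxs' hys' hz
  · exact Set.eq_empty_iff_forall_notMem.1 hX _ ⟨hsum, _, isSumColoured_add hxs' hys', rfl⟩

theorem eval_append {α β : Type*} {g : α → β} (ev : List β → β) (op : β → β → β)
    (hev : ∀ l₁ l₂, ev (l₁ ++ l₂) = op (ev l₁) (ev l₂)) (W : ℕ → List α) (l₁ l₂ : List ℕ) :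
    ev ((((l₁ ++ l₂).map W).flatten).map g) =
      op (ev (((l₁.map W).flatten).map g)) (ev (((l₂.map W).flatten).map g)) := by
  rw [List.map_append, List.flatten_append, List.map_append, hev]

/-- A sequence of blocks `W` of matrix entries of `b`, each realised by an orderly term, such that
the values of all finite concatenations have the same colour, gives a homogeneous reduction. -/
theorem exists_homogeneous_reduction {S : Set (HetOp (Fin 2) (MatU 𝔽 n))}
    (hS : S ⊆ {matAddOp 𝔽 n, matMulOp 𝔽 n, scalAddOp 𝔽 n, scalMulOp 𝔽 n, detOp 𝔽 n})
    {e : ℕ → Fin 2} (he : InOmega e) (he0 : e 0 = 1) {b : ℕ → MatU 𝔽 n}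
    (hb : Sorted (matPhyla 𝔽 n) e b)
    (ev : List (Matrix (Fin n) (Fin n) 𝔽) → Matrix (Fin n) (Fin n) 𝔽)
    (hev_add : matAddOp 𝔽 n ∈ S → ∀ l₁ l₂, ev (l₁ ++ l₂) = ev l₁ + ev l₂)
    (hev_mul : matMulOp 𝔽 n ∈ S → ∀ l₁ l₂, ev (l₁ ++ l₂) = ev l₁ * ev l₂)
    (W : ℕ → List ℕ) (hWne : ∀ k, W k ≠ []) (hWlt : ∀ k, (W k).Pairwise (· < ·))
    (hWW : ∀ j k, j < k → ∀ x ∈ W j, ∀ y ∈ W k, x < y) (hWe : ∀ k, ∀ i ∈ W k, e i = 1)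
    (hreal : ∀ k, ∃ f, OT S f ∧ f.inSorts = List.replicate (W k).length 1 ∧
      f.fn ((W k).map b) = Sum.inr (ev ((W k).map fun i => toMat (b i))))
    (C : Set (Matrix (Fin n) (Fin n) 𝔽))
    (hC : ∀ ks : List ℕ, ks ≠ [] → ks.Pairwise (· < ·) →
      ev (((ks.map W).flatten).map fun i => toMat (b i)) ∈ C) :
    ∃ a, Reduction (matPhyla 𝔽 n) S a b ∧ Sorted (matPhyla 𝔽 n) e a ∧
      ∀ x ∈ FR (matPhyla 𝔽 n) S e a, ∃ m ∈ C, x = Sum.inr m := by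
  have hWge : ∀ k, ∀ x ∈ W k, k ≤ x := by
    intro k
    induction k with
    | zero => exact fun _ _ => Nat.zero_le _
    | succ k ih =>
      intro x hx
      obtain ⟨y, hy⟩ := List.exists_mem_of_ne_nil _ (hWne k)
      have := hWW k (k + 1) (by omega) y hy x hx
      have := ih y hy
      omega
  have hblock : ∀ j N, ∃ l, ((e j = 1 ∧ ∃ k, l = W k) ∨ (e j = 0 ∧ ∃ i, e i = 0 ∧ l = [i])) ∧
      ∀ x ∈ l, N ≤ x := by
    intro j N
    by_cases h : e j = 1
    · exact ⟨W N, Or.inl ⟨h, N, rfl⟩, hWge N⟩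
    · have h0 : e j = 0 := by omega
      obtain ⟨i, hi, hij⟩ := he.exists_ge j N
      exact ⟨[i], Or.inr ⟨h0, i, hij.trans h0, rfl⟩, by simpa using hi⟩
  obtain ⟨l₀, hl₀, -⟩ := hblock 0 0
  obtain ⟨φ, hφ0, hφ, hlt⟩ := exists_increasing_blocks l₀ _ hblock
  have hφ : ∀ j, (e j = 1 ∧ ∃ k, φ j = W k) ∨ (e j = 0 ∧ ∃ i, e i = 0 ∧ φ j = [i]) := by
    intro j
    cases j with
    | zero => rw [hφ0]; exact hl₀
    | succ j => exact hφ j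
  have hterm : ∀ j, ∃ f, OT S f ∧
      List.Forall₂ (fun i ξ => b i ∈ matPhyla 𝔽 n ξ) (φ j) f.inSorts ∧
      f.fn ((φ j).map b) ∈ matPhyla 𝔽 n (e j) ∧
      (e j = 1 → f.fn ((φ j).map b) = Sum.inr (ev ((φ j).map fun i => toMat (b i)))) := by
    intro j
    rcases hφ j with ⟨hj, k, hk⟩ | ⟨hj, i, hi, hk⟩
    · obtain ⟨f, hf, hin, hfn⟩ := hreal k
      rw [hk, hj]
      refine ⟨f, hf, ?_, mem_matPhyla_one.2 ⟨_, hfn.symm⟩, fun _ => hfn⟩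
      rw [hin, List.forall₂_iff_get]
      refine ⟨by simp, fun i h₁ h₂ => ?_⟩
      have h1 := hb ((W k).get ⟨i, h₁⟩)
      rw [hWe k _ (List.get_mem _ _)] at h1
      simpa using h1
    · refine ⟨idOp 0, OT_idOp _ _, ?_, ?_, fun h => ?_⟩
      · rw [hk]
        refine .cons ?_ .nil
        rw [← hi]
        exact hb i
      · rw [hk, hj, ← hi]
        exact hb i
      · rw [hj] at h
        exact absurd h (by decide)
  choose f hf hs hA hval using hterm
  choose! κ hκ using fun j (hj : e j = 1) => ((hφ j).resolve_right fun h => by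
    rw [hj] at h
    exact absurd h.1 (by decide)).2
  have hκlt : ∀ j k, j < k → e j = 1 → e k = 1 → κ j < κ k := by
    intro j k hjk hj hk
    obtain ⟨x, hx⟩ := List.exists_mem_of_ne_nil _ (hWne (κ j))
    obtain ⟨y, hy⟩ := List.exists_mem_of_ne_nil _ (hWne (κ k))
    have hcmp := hlt j k hjk
    rw [hκ j hj, hκ k hk] at hcmp
    by_contra! hle
    rcases hle.lt_or_eq with h | h
    · exact lt_asymm (hcmp x hx y hy) (hWW _ _ h y hy x hx)
    · rw [← h] at hx
      exact lt_irrefl _ (hcmp x (h ▸ hx) x hx)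
  let a : ℕ → MatU 𝔽 n := fun j => (f j).fn ((φ j).map b)
  have ha : Sorted (matPhyla 𝔽 n) e a := hA
  refine ⟨a, ⟨φ, f, hf, fun j => ?_, hlt, hs, fun _ => rfl⟩, ha, ?_⟩
  · refine List.isChain_iff_pairwise.2 ?_
    rcases hφ j with ⟨-, k, hk⟩ | ⟨-, i, -, hk⟩
    · rw [hk]
      exact hWlt k
    · rw [hk]
      exact List.pairwise_singleton _ _
  · rintro x ⟨a', ⟨ψ, g, hg, hψ, -, hgs, hgval⟩, ha', rfl⟩
    have h0 := ha' 0
    rw [he0] at h0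
    obtain ⟨m, hm⟩ := mem_matPhyla_one.1 h0
    obtain ⟨hne, he1, hmval⟩ := (OT_matrix_value hS a
      (fun ns m => ns ≠ [] ∧ (∀ j ∈ ns, e j = 1) ∧
        m = ev (((ns.map φ).flatten).map fun i => toMat (b i))) (by
          intro j m hj
          have hej : e j = 1 := by
            by_contra hej
            have h1 := ha j
            rw [show e j = 0 by omega, hj] at h1
            obtain ⟨r, hr⟩ := mem_matPhyla_zero.1 h1
            cases hr
          refine ⟨by simp, by simpa using hej, ?_⟩
          rw [← Sum.inr.inj ((hval j hej).symm.trans hj)]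
          simp)
        (fun h l₁ l₂ x y ⟨h₁, h₁', hx⟩ ⟨h₂, h₂', hy⟩ => ⟨by simp [h₁], fun j hj =>
          (List.mem_append.1 hj).elim (h₁' j) (h₂' j), by
            rw [hx, hy, eval_append ev _ (hev_add h)]⟩)
        (fun h l₁ l₂ x y ⟨h₁, h₁', hx⟩ ⟨h₂, h₂', hy⟩ => ⟨by simp [h₁], fun j hj =>
          (List.mem_append.1 hj).elim (h₁' j) (h₂' j), by
            rw [hx, hy, eval_append ev _ (hev_mul h)]⟩)
        (hg 0) (ψ 0) (hgs 0)).2 m ((hgval 0).symm.trans hm.symm)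
    refine ⟨m, ?_, hm.symm⟩
    have hmap : (ψ 0).map φ = ((ψ 0).map κ).map W := by
      rw [List.map_map]
      exact List.map_congr_left fun j hj => hκ j (he1 j hj)
    rw [hmval, hmap]
    refine hC _ (by simpa using hne) (List.pairwise_map.2 ?_)
    exact (List.isChain_iff_pairwise.1 (hψ 0)).imp_of_mem fun hj hk hjk =>
      hκlt _ _ hjk (he1 _ hj) (he1 _ hk)

theorem prod_mem_FP_drop {M : Type*} [Monoid M] (w : Stream' M) (k : ℕ) (ks : List ℕ)
    (hlt : (k :: ks).Pairwise (· < ·)) :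
    ((k :: ks).map w.get).prod ∈ Hindman.FP (w.drop k) := by
  induction ks generalizing k with
  | nil => simpa using Hindman.FP.head (w.drop k)
  | cons k' ks ih =>
    obtain ⟨hk, hks⟩ := List.pairwise_cons.1 hlt
    obtain ⟨d, hd⟩ := Nat.exists_eq_add_of_le (hk k' (by simp))
    have h := ih k' hks
    rw [hd, Nat.succ_eq_add_one, ← Stream'.drop_drop] at h
    have h := Hindman.FP_drop_subset_FP _ _ h
    rw [← Stream'.tail_drop'] at h
    have h := Hindman.FP.cons _ _ h
    rw [Stream'.head_drop, ← Nat.succ_eq_add_one, ← hd] at h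
    rwa [List.map_cons, List.prod_cons]

theorem FP_letters {p : ℕ → Prop} (a : Stream' (FreeMonoid ℕ)) (c : ℕ → ℕ) (hc : StrictMono c)
    (hp : ∀ k, p (c k))
    (ha : ∀ k, a.get k = FreeMonoid.of (c k)) {m : FreeMonoid ℕ}
    (hm : m ∈ Hindman.FP a) :
    m.toList ≠ [] ∧ m.toList.Pairwise (· < ·) ∧ ∀ x ∈ m.toList, p x ∧ c 0 ≤ x := by
  induction hm generalizing c with
  | head' a =>
    have h : a.head = FreeMonoid.of (c 0) := ha 0
    simp [h, hp]
  | tail' a m _ ih =>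
    obtain ⟨h₁, h₂, h₃⟩ := ih (fun k => c (k + 1)) (fun _ _ h => hc (Nat.succ_lt_succ h))
      (fun k => hp _) fun k => ha _
    exact ⟨h₁, h₂, fun x hx => ⟨(h₃ x hx).1, (hc Nat.zero_lt_one).le.trans (h₃ x hx).2⟩⟩
  | cons' a m _ ih =>
    obtain ⟨h₁, h₂, h₃⟩ := ih (fun k => c (k + 1)) (fun _ _ h => hc (Nat.succ_lt_succ h))
      (fun k => hp _) fun k => ha _
    have h : a.head = FreeMonoid.of (c 0) := ha 0
    have hlt : ∀ x ∈ m.toList, c 0 < x := fun x hx => (hc Nat.zero_lt_one).trans_le (h₃ x hx).2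
    rw [h, FreeMonoid.toList_mul, FreeMonoid.toList_of, List.singleton_append]
    refine ⟨List.cons_ne_nil _ _, List.pairwise_cons.2 ⟨hlt, h₂⟩, fun x hx => ?_⟩
    rcases List.mem_cons.1 hx with rfl | hx
    · exact ⟨hp 0, le_rfl⟩
    · exact ⟨(h₃ x hx).1, (hlt x hx).le⟩

/-- Hindman's theorem for concatenations of increasing blocks of natural numbers. -/
theorem exists_homogeneous_blocks {p : ℕ → Prop} (hp : {i | p i}.Infinite) (D : Set (List ℕ)) :
    ∃ W : ℕ → List ℕ, (∀ k, W k ≠ []) ∧ (∀ k, (W k).Pairwise (· < ·)) ∧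
      (∀ j k, j < k → ∀ x ∈ W j, ∀ y ∈ W k, x < y) ∧ (∀ k, ∀ i ∈ W k, p i) ∧
      ((∀ ks : List ℕ, ks ≠ [] → ks.Pairwise (· < ·) → (ks.map W).flatten ∈ D) ∨
        ∀ ks : List ℕ, ks ≠ [] → ks.Pairwise (· < ·) → (ks.map W).flatten ∈ Dᶜ) := by
  let c := Nat.nth p
  let a : Stream' (FreeMonoid ℕ) := fun k => FreeMonoid.of (c k)
  let part : Set (List ℕ) → Set (FreeMonoid ℕ) := fun D => {m | m ∈ Hindman.FP a ∧ m.toList ∈ D}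
  obtain ⟨s, hs, w, hw⟩ := Hindman.FP_partition_regular a {part D, part Dᶜ} (by simp) (by
    intro m hm
    by_cases h : m.toList ∈ D
    · exact ⟨part D, by simp, hm, h⟩
    · exact ⟨part Dᶜ, by simp, hm, h⟩)
  have hflat : ∀ ks : List ℕ, (ks.map w.get).prod.toList =
      (ks.map fun k => (w.get k).toList).flatten := by
    intro ks
    rw [FreeMonoid.toList_prod, List.map_map]
    rfl
  have hmem : ∀ ks : List ℕ, ks ≠ [] → ks.Pairwise (· < ·) → (ks.map w.get).prod ∈ s := by
    intro ks hne hlt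
    obtain ⟨k, ks, rfl⟩ := List.exists_cons_of_ne_nil hne
    exact hw (Hindman.FP_drop_subset_FP _ _ (prod_mem_FP_drop w k ks hlt))
  have hsFP : ∀ m ∈ s, m ∈ Hindman.FP a := by
    rcases hs with rfl | rfl <;> exact fun m hm => hm.1
  have hword : ∀ ks : List ℕ, ks ≠ [] → ks.Pairwise (· < ·) → _ := fun ks hne hlt =>
    FP_letters (p := p) a c (Nat.nth_strictMono hp) (Nat.nth_mem_of_infinite hp) (fun _ => rfl)
      (hsFP _ (hmem ks hne hlt))
  simp only [hflat] at hword
  have hone : ∀ k, _ := fun k => hword [k] (by simp) (by simp)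
  simp only [List.map_cons, List.map_nil, List.flatten_cons, List.flatten_nil,
    List.append_nil] at hone
  refine ⟨fun k => (w.get k).toList, fun k => (hone k).1, fun k => (hone k).2.1,
    fun j k hjk => ?_, fun k i hi => ((hone k).2.2 i hi).1, ?_⟩
  · have h := (hword [j, k] (by simp) (by simpa using hjk)).2.1
    simp only [List.map_cons, List.map_nil, List.flatten_cons, List.flatten_nil,
      List.append_nil] at h
    exact (List.pairwise_append.1 h).2.2
  · rcases hs with rfl | rfl
    · exact Or.inl fun ks hne hlt => hflat ks ▸ (hmem ks hne hlt).2
    · exact Or.inr fun ks hne hlt => hflat ks ▸ (hmem ks hne hlt).2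

theorem exists_OT_fold {S : Set (HetOp (Fin 2) (MatU 𝔽 n))} {g : HetOp (Fin 2) (MatU 𝔽 n)}
    (hgS : g ∈ S) (hin : g.inSorts = [1, 1]) (hout : g.outSort = 1)
    (op : Matrix (Fin n) (Fin n) 𝔽 → Matrix (Fin n) (Fin n) 𝔽 → Matrix (Fin n) (Fin n) 𝔽)
    (hg : ∀ x y, g.fn [Sum.inr x, Sum.inr y] = Sum.inr (op x y))
    (ev : List (Matrix (Fin n) (Fin n) 𝔽) → Matrix (Fin n) (Fin n) 𝔽) (hev_one : ∀ x, ev [x] = x)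
    (hev : ∀ l₁ l₂, ev (l₁ ++ l₂) = op (ev l₁) (ev l₂)) (k : ℕ) :
    ∃ f, OT S f ∧ f.outSort = 1 ∧ f.inSorts = List.replicate (k + 1) 1 ∧
      ∀ ms : List (Matrix (Fin n) (Fin n) 𝔽), ms.length = k + 1 →
        f.fn (ms.map Sum.inr) = Sum.inr (ev ms) := by
  induction k with
  | zero =>
    refine ⟨idOp 1, OT_idOp _ _, rfl, rfl, fun ms hms => ?_⟩
    obtain ⟨m, rfl⟩ := List.length_eq_one_iff.1 hms
    rw [hev_one]
    rfl
  | succ k ih =>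
    obtain ⟨f, hf, hfout, hfin, hfn⟩ := ih
    refine ⟨_, OT.comp g [idOp 1, f] hgS ?_ ?_, hout, ?_, fun ms hms => ?_⟩
    · intro h hh
      rcases List.mem_cons.1 hh with rfl | hh
      · exact OT_idOp _ _
      · rw [List.mem_singleton.1 hh]
        exact hf
    · rw [hin]
      exact .cons rfl (.cons hfout .nil)
    · simp [hfin, idOp, List.replicate_succ]
    · obtain ⟨m, ms, rfl⟩ := List.exists_cons_of_length_eq_add_one hms
      have hlen : ms.length = k + 1 := by simpa using hms
      have hch : applyChunks [idOp 1, f] ((m :: ms).map Sum.inr) =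
          [Sum.inr m, f.fn (ms.map Sum.inr)] := by
        simp only [applyChunks, idOp, hfin, List.map_cons, List.length_cons, List.length_nil,
          List.length_replicate, List.take_succ_cons, List.drop_succ_cons, List.take_zero,
          List.drop_zero, List.headD_cons, zero_add]
        rw [List.take_of_length_le (by simp [hlen])]
      simp only [hch, hfn ms hlen, hg]
      rw [← List.singleton_append, hev, hev_one]

theorem isERamsey_of_not_both {S : Set (HetOp (Fin 2) (MatU 𝔽 n))}
    (hS : S ⊆ {matAddOp 𝔽 n, matMulOp 𝔽 n, scalAddOp 𝔽 n, scalMulOp 𝔽 n, detOp 𝔽 n})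
    {e : ℕ → Fin 2} (he : InOmega e) (he0 : e 0 = 1)
    (hnot : ¬(matAddOp 𝔽 n ∈ S ∧ matMulOp 𝔽 n ∈ S)) : IsERamsey (matPhyla 𝔽 n) S e := by
  intro b hb X hX
  let mb : ℕ → Matrix (Fin n) (Fin n) 𝔽 := fun i => toMat (b i)
  let C : Set (Matrix (Fin n) (Fin n) 𝔽) := {m | Sum.inr m ∈ X}
  have hbm : ∀ i, e i = 1 → b i = Sum.inr (mb i) := by
    intro i hi
    have h := hb i
    rw [hi] at h
    obtain ⟨m, hm⟩ := mem_matPhyla_one.1 h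
    simp only [mb, ← hm, toMat]
  have hinf : {i | e i = 1}.Infinite := he0 ▸ he 0
  obtain ⟨ev, W, hadd, hmul, hne, hlt, hWW, hWe, hreal, hhom⟩ :
      ∃ (ev : List (Matrix (Fin n) (Fin n) 𝔽) → Matrix (Fin n) (Fin n) 𝔽) (W : ℕ → List ℕ),
      (matAddOp 𝔽 n ∈ S → ∀ l₁ l₂, ev (l₁ ++ l₂) = ev l₁ + ev l₂) ∧
      (matMulOp 𝔽 n ∈ S → ∀ l₁ l₂, ev (l₁ ++ l₂) = ev l₁ * ev l₂) ∧
      (∀ k, W k ≠ []) ∧ (∀ k, (W k).Pairwise (· < ·)) ∧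
      (∀ j k, j < k → ∀ x ∈ W j, ∀ y ∈ W k, x < y) ∧ (∀ k, ∀ i ∈ W k, e i = 1) ∧
      (∀ k, ∃ f, OT S f ∧ f.inSorts = List.replicate (W k).length 1 ∧
        f.fn ((W k).map b) = Sum.inr (ev ((W k).map mb))) ∧
      ((∀ ks : List ℕ, ks ≠ [] → ks.Pairwise (· < ·) → ev (((ks.map W).flatten).map mb) ∈ C) ∨
        ∀ ks : List ℕ, ks ≠ [] → ks.Pairwise (· < ·) → ev (((ks.map W).flatten).map mb) ∈ Cᶜ) := by
    have hop : ∀ g ∈ S, g.inSorts = [1, 1] → g.outSort = 1 →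
        ∀ op : Matrix (Fin n) (Fin n) 𝔽 → Matrix (Fin n) (Fin n) 𝔽 → Matrix (Fin n) (Fin n) 𝔽,
        (∀ x y, g.fn [Sum.inr x, Sum.inr y] = Sum.inr (op x y)) →
        ∀ ev : List (Matrix (Fin n) (Fin n) 𝔽) → Matrix (Fin n) (Fin n) 𝔽, (∀ x, ev [x] = x) →
        (∀ l₁ l₂, ev (l₁ ++ l₂) = op (ev l₁) (ev l₂)) → ∀ ns : List ℕ, ns ≠ [] →
        (∀ i ∈ ns, e i = 1) → ∃ f, OT S f ∧ f.inSorts = List.replicate ns.length 1 ∧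
          f.fn (ns.map b) = Sum.inr (ev (ns.map mb)) := by
      intro g hgS hin hout op hg ev hev_one hev ns hns hns1
      obtain ⟨f, hf, -, hfin, hfn⟩ := exists_OT_fold hgS hin hout op hg ev hev_one hev
        (ns.length - 1)
      have hlen : ns.length = ns.length - 1 + 1 :=
        (Nat.sub_add_cancel (List.length_pos_iff.2 hns)).symm
      refine ⟨f, hf, by rw [hfin, ← hlen], ?_⟩
      rw [← hfn (ns.map mb) (by rwa [List.length_map]), List.map_map]
      exact congrArg _ (List.map_congr_left fun i hi => hbm i (hns1 i hi))
    by_cases ha : matAddOp 𝔽 n ∈ S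
    · obtain ⟨W, hne, hlt, hWW, hWe, hhom⟩ :=
        exists_homogeneous_blocks hinf {l | (l.map mb).sum ∈ C}
      exact ⟨List.sum, W, fun _ _ _ => List.sum_append, fun hm => absurd ⟨ha, hm⟩ hnot, hne, hlt,
        hWW, hWe, fun k => hop _ ha rfl rfl (· + ·) (fun _ _ => rfl) List.sum
          (fun _ => List.sum_singleton) (fun _ _ => List.sum_append) _ (hne k) (hWe k), hhom⟩
    by_cases hm : matMulOp 𝔽 n ∈ S
    · obtain ⟨W, hne, hlt, hWW, hWe, hhom⟩ :=
        exists_homogeneous_blocks hinf {l | (l.map mb).prod ∈ C}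
      exact ⟨List.prod, W, fun h => absurd h ha, fun _ _ _ => List.prod_append, hne, hlt,
        hWW, hWe, fun k => hop _ hm rfl rfl (· * ·) (fun _ _ => rfl) List.prod
          (fun _ => List.prod_singleton) (fun _ _ => List.prod_append) _ (hne k) (hWe k), hhom⟩
    · have hpigeon : ∀ D : Set (Matrix (Fin n) (Fin n) 𝔽), {i | e i = 1 ∧ mb i ∈ D}.Infinite →
          ∃ W : ℕ → List ℕ, (∀ k, W k ≠ []) ∧ (∀ k, (W k).Pairwise (· < ·)) ∧
          (∀ j k, j < k → ∀ x ∈ W j, ∀ y ∈ W k, x < y) ∧ (∀ k, ∀ i ∈ W k, e i = 1) ∧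
          (∀ k, ∃ f, OT S f ∧ f.inSorts = List.replicate (W k).length 1 ∧
            f.fn ((W k).map b) = Sum.inr (((W k).map mb).headD 0)) ∧
          ∀ ks : List ℕ, ks ≠ [] → ks.Pairwise (· < ·) →
            (((ks.map W).flatten).map mb).headD 0 ∈ D := by
        intro D hD
        have hnth := fun k => Nat.nth_mem_of_infinite hD k
        refine ⟨fun k => [Nat.nth _ k], by simp, by simp, ?_, ?_, fun k => ⟨idOp 1, OT_idOp _ _,
          rfl, hbm _ (hnth k).1⟩, ?_⟩
        · intro j k hjk x hx y hy
          rw [List.mem_singleton.1 hx, List.mem_singleton.1 hy]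
          exact Nat.nth_strictMono hD hjk
        · intro k i hi
          rw [List.mem_singleton.1 hi]
          exact (hnth k).1
        · intro ks hks _
          obtain ⟨k, ks, rfl⟩ := List.exists_cons_of_ne_nil hks
          exact (hnth k).2
      have hsplit : {i | e i = 1} = {i | e i = 1 ∧ mb i ∈ C} ∪ {i | e i = 1 ∧ mb i ∈ Cᶜ} := by
        ext i
        by_cases h : mb i ∈ C <;> simp [h]
      rw [hsplit, Set.infinite_union] at hinf
      rcases hinf with h | h
      · obtain ⟨W, h₁, h₂, h₃, h₄, h₅, h₆⟩ := hpigeon _ h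
        exact ⟨fun l => l.headD 0, W, fun h => absurd h ha, fun h => absurd h hm, h₁, h₂, h₃, h₄,
          h₅, Or.inl h₆⟩
      · obtain ⟨W, h₁, h₂, h₃, h₄, h₅, h₆⟩ := hpigeon _ h
        exact ⟨fun l => l.headD 0, W, fun h => absurd h ha, fun h => absurd h hm, h₁, h₂, h₃, h₄,
          h₅, Or.inr h₆⟩
  rcases hhom with hhom | hhom
  · obtain ⟨a, hred, hsorted, hFR⟩ := exists_homogeneous_reduction hS he he0 hb ev hadd hmul W hne
      hlt hWW hWe hreal C hhom
    refine ⟨a, hred, hsorted, Or.inl fun x hx => ?_⟩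
    obtain ⟨m, hm, rfl⟩ := hFR x hx
    exact hm
  · obtain ⟨a, hred, hsorted, hFR⟩ := exists_homogeneous_reduction hS he he0 hb ev hadd hmul W hne
      hlt hWW hWe hreal Cᶜ hhom
    refine ⟨a, hred, hsorted, Or.inr (Set.eq_empty_iff_forall_notMem.2 ?_)⟩
    rintro x ⟨hx, hxX⟩
    obtain ⟨m, hm, rfl⟩ := hFR x hx
    exact hm hxX

end HetRamsey

/-- for `e ∈ Ω₁`, a reduct of the full matrix algebra
`(Mₙ(𝔽), 𝔽, +, ×, +_𝔽, ×_𝔽, |·|)` is `e`-Ramsey iff it does not contain both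
matrix operations. -/
theorem reduct_eRamsey_iff_not_both_matrix_ops
    (𝔽 : Type) [Field 𝔽] [CharZero 𝔽] (n : ℕ) (hn : 0 < n)
    (S : Set (HetOp (Fin 2) (MatU 𝔽 n)))
    (hS : S ⊆ {matAddOp 𝔽 n, matMulOp 𝔽 n, scalAddOp 𝔽 n, scalMulOp 𝔽 n, detOp 𝔽 n})
    (e : ℕ → Fin 2) (he : InOmega e) (he0 : e 0 = 1) :
    IsERamsey (matPhyla 𝔽 n) S e ↔ ¬(matAddOp 𝔽 n ∈ S ∧ matMulOp 𝔽 n ∈ S) := by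
  exact ⟨fun h hboth => not_isERamsey_of_both hn hS he he0 hboth.1 hboth.2 h,
    isERamsey_of_not_both hS he he0⟩
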